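/- If u is a finite Blaschke product and v is any inner function of infinite degree (i.e., v is not a finite Blaschke product), then 𝓜(u,v) ∩ H^∞ ≠ {0}; that is, there is a nonzero bounded analytic multiplier from K_u into K_v. -/

import Mathlib

open Complex MeasureTheory Metric Filter Set Topology

noncomputable section

/-- The `n`-th Taylor coefficient of `f` at `0`. -/
def hcoeff (f : ℂ → ℂ) (n : ℕ) : ℂ := iteratedDeriv n f 0 / n.factorial

/-- Membership in the Hardy space `H²` of the open unit disk, described via
square-summability of the Taylor coefficients. -/
def MemH2 (f : ℂ → ℂ) : Prop :=
  DifferentiableOn ℂ f (ball (0 : ℂ) 1) ∧ Summable fun n => ‖hcoeff f n‖ ^ 2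

/-- The `H²` inner product, conjugate-linear in the first variable. -/
def hInner (f g : ℂ → ℂ) : ℂ := ∑' n : ℕ, (starRingEnd ℂ) (hcoeff f n) * hcoeff g n

/-- The squared `H²` norm. -/
def hNormSq (f : ℂ → ℂ) : ℝ := ∑' n : ℕ, ‖hcoeff f n‖ ^ 2

/-- Membership in `H^∞`: bounded analytic functions on the disk. -/
def MemHinf (f : ℂ → ℂ) : Prop :=
  DifferentiableOn ℂ f (ball (0 : ℂ) 1) ∧ ∃ C : ℝ, ∀ z ∈ ball (0 : ℂ) 1, ‖f z‖ ≤ C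

/-- An inner function: bounded analytic on the disk with unimodular radial
boundary values almost everywhere. -/
def IsInner (u : ℂ → ℂ) : Prop :=
  MemHinf u ∧
    ∀ᵐ θ : ℝ, ∃ L : ℂ, ‖L‖ = 1 ∧
      Tendsto (fun r : ℝ => u ((r : ℂ) * Complex.exp ((θ : ℂ) * Complex.I)))
        (𝓝[<] (1 : ℝ)) (𝓝 L)

/-- The model space `K_Θ = H² ⊖ Θ H²`: elements of `H²` orthogonal to `Θ H²`. -/
def KSpace (Θ : ℂ → ℂ) : Set (ℂ → ℂ) :=
  {f | MemH2 f ∧ ∀ g : ℂ → ℂ, MemH2 g → hInner (fun z => Θ z * g z) f = 0}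

/-- The multiplier space `𝓜(u, v) = {φ analytic on 𝔻 : φ · K_u ⊆ K_v}`. -/
def Mult (u v : ℂ → ℂ) : Set (ℂ → ℂ) :=
  {φ | DifferentiableOn ℂ φ (ball (0 : ℂ) 1) ∧
    ∀ f ∈ KSpace u, (fun z => φ z * f z) ∈ KSpace v}

/-- Radial boundary value of `f` at the point `e^{iθ}` of the unit circle. -/
def bdry (f : ℂ → ℂ) (θ : ℝ) : ℂ :=
  limUnder (𝓝[<] (1 : ℝ)) fun r : ℝ => f ((r : ℂ) * Complex.exp ((θ : ℂ) * Complex.I))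

/-- The kernel of the Toeplitz operator `T_{conj(z v) u}` on `H²`:
those `φ ∈ H²` with `P₊(conj(z v) u φ) = 0`, i.e. `conj(z v) u φ ⟂ H²`
in `L²` of the circle. -/
def kerToeplitzZVU (u v : ℂ → ℂ) : Set (ℂ → ℂ) :=
  {φ | MemH2 φ ∧ ∀ h : ℂ → ℂ, MemH2 h →
    (∫ θ in (0 : ℝ)..(2 * Real.pi),
      (starRingEnd ℂ) (Complex.exp ((θ : ℂ) * Complex.I) * bdry v θ) * bdry u θ * bdry φ θ *
        (starRingEnd ℂ) (bdry h θ)) = 0}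

/-- `|φ|² dm` is a Carleson measure for `K_u`. -/
def IsCarlesonForK (u φ : ℂ → ℂ) : Prop :=
  ∃ C : ℝ, ∀ f ∈ KSpace u,
    (∫ θ in (0 : ℝ)..(2 * Real.pi), ‖bdry f θ‖ ^ 2 * ‖bdry φ θ‖ ^ 2) ≤ C * hNormSq f

/-- The backward shift `(S^* f)(z) = (f(z) - f(0))/z`. -/
def bShift (f : ℂ → ℂ) : ℂ → ℂ := fun z =>
  if z = 0 then deriv f 0 else (f z - f 0) / z

/-- The reproducing kernel of the model space `K_Θ`. -/
def repKer (Θ : ℂ → ℂ) (lam : ℂ) : ℂ → ℂ := fun z =>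
  (1 - (starRingEnd ℂ) (Θ lam) * Θ z) / (1 - (starRingEnd ℂ) lam * z)

/-- A single Blaschke factor with zero at `a ∈ 𝔻`. -/
def blaschkeFactor (a : ℂ) : ℂ → ℂ := fun z =>
  if a = 0 then z else ((‖a‖ : ℂ) / a) * ((a - z) / (1 - (starRingEnd ℂ) a * z))

/-- A finite Blaschke product (on the disk). -/
def IsFiniteBlaschke (B : ℂ → ℂ) : Prop :=
  ∃ (c : ℂ) (N : ℕ) (a : Fin N → ℂ), ‖c‖ = 1 ∧ (∀ i, a i ∈ ball (0 : ℂ) 1) ∧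
    ∀ z ∈ ball (0 : ℂ) 1, B z = c * ∏ i, blaschkeFactor (a i) z

/-- The boundary spectrum `σ(u) = {ξ ∈ 𝕋 : liminf_{z → ξ, z ∈ 𝔻} |u(z)| = 0}`. -/
def bdrySpec (u : ℂ → ℂ) : Set ℂ :=
  {ξ | ‖ξ‖ = 1 ∧ Filter.liminf (fun z => ‖u z‖) (𝓝[ball (0 : ℂ) 1] ξ) = 0}

/-- An outer function:
`F(z) = c · exp(∫_𝕋 (ξ+z)/(ξ-z) log w(ξ) dm(ξ))` for a unimodular constant `c`
and a nonnegative weight `w` with `log w ∈ L¹`. -/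
def IsOuter (F : ℂ → ℂ) : Prop :=
  ∃ (c : ℂ) (w : ℝ → ℝ), ‖c‖ = 1 ∧ (∀ θ, 0 ≤ w θ) ∧
    IntervalIntegrable (fun θ => |Real.log (w θ)|) volume 0 (2 * Real.pi) ∧
    ∀ z ∈ ball (0 : ℂ) 1,
      F z = c * Complex.exp ((2 * (Real.pi : ℂ))⁻¹ *
        ∫ θ in (0 : ℝ)..(2 * Real.pi),
          ((Complex.exp ((θ : ℂ) * Complex.I) + z) /
              (Complex.exp ((θ : ℂ) * Complex.I) - z)) * (Real.log (w θ) : ℂ))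


lemma hasSum_congr_fun {α : Type*} {f g : ℕ → α} [AddCommMonoid α] [TopologicalSpace α] {a : α}
    (h : ∀ n, f n = g n) : HasSum f a ↔ HasSum g a := by
  rw [funext h]

lemma contDiffAt_zero_of_disk {f : ℂ → ℂ} (hf : DifferentiableOn ℂ f (ball (0 : ℂ) 1))
    (n : WithTop ℕ∞) : ContDiffAt ℂ n f 0 :=
  (hf.analyticAt (ball_mem_nhds _ one_pos)).contDiffAt

lemma hcoeff_congr {f g : ℂ → ℂ} (h : EqOn f g (ball (0 : ℂ) 1)) (n : ℕ) :
    hcoeff f n = hcoeff g n := by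
  have : f =ᶠ[𝓝 0] g := h.eventuallyEq_of_mem (ball_mem_nhds _ one_pos)
  rw [hcoeff, hcoeff, this.iteratedDeriv_eq]

lemma hasSum_hcoeff {f : ℂ → ℂ} (hf : DifferentiableOn ℂ f (ball (0 : ℂ) 1)) {z : ℂ}
    (hz : z ∈ ball (0 : ℂ) 1) : HasSum (fun n => hcoeff f n * z ^ n) (f z) := by
  refine (hasSum_congr_fun fun n => ?_).2 (Complex.hasSum_taylorSeries_on_ball hf hz)
  simp only [hcoeff, sub_zero, smul_eq_mul]
  ring

lemma hcoeff_mul {f g : ℂ → ℂ} (hf : DifferentiableOn ℂ f (ball (0 : ℂ) 1))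
    (hg : DifferentiableOn ℂ g (ball (0 : ℂ) 1)) (n : ℕ) :
    hcoeff (fun z => f z * g z) n =
      ∑ p ∈ Finset.HasAntidiagonal.antidiagonal n, hcoeff f p.1 * hcoeff g p.2 := by
  rw [hcoeff, iteratedDeriv_fun_mul (contDiffAt_zero_of_disk hf _) (contDiffAt_zero_of_disk hg _),
    Finset.sum_div, Finset.Nat.sum_antidiagonal_eq_sum_range_succ_mk]
  refine Finset.sum_congr rfl fun i hi => ?_
  have hi' : i ≤ n := Nat.lt_succ_iff.mp (Finset.mem_range.mp hi)
  have h1 : (n.factorial : ℂ) ≠ 0 := by exact_mod_cast n.factorial_ne_zero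
  have h2 : (i.factorial : ℂ) ≠ 0 := by exact_mod_cast i.factorial_ne_zero
  have h3 : ((n - i).factorial : ℂ) ≠ 0 := by exact_mod_cast (n - i).factorial_ne_zero
  have h4 : (n.choose i : ℂ) * i.factorial * (n - i).factorial = n.factorial := by
    exact_mod_cast Nat.choose_mul_factorial_mul_factorial hi'
  simp only [hcoeff]
  rw [← h4]
  have h5 : (n.choose i : ℂ) ≠ 0 := by
    intro h; rw [h] at h4; simp at h4; exact h1 h4.symm
  field_simp

lemma iteratedDeriv_polynomial (P : Polynomial ℂ) (n : ℕ) :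
    iteratedDeriv n (fun z => P.eval z) = fun z => ((Polynomial.derivative^[n]) P).eval z := by
  induction n with
  | zero => simp
  | succ n ih =>
    rw [iteratedDeriv_succ, ih, Function.iterate_succ_apply']
    funext z
    exact Polynomial.deriv _

lemma hcoeff_polynomial (P : Polynomial ℂ) (n : ℕ) :
    hcoeff (fun z => P.eval z) n = P.coeff n := by
  have h1 : (n.factorial : ℂ) ≠ 0 := by exact_mod_cast n.factorial_ne_zero
  rw [hcoeff, iteratedDeriv_polynomial]
  simp only [← Polynomial.coeff_zero_eq_eval_zero, Polynomial.coeff_iterate_derivative, zero_add,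
    Nat.descFactorial_self, nsmul_eq_mul]
  field_simp

lemma hcoeff_zero (f : ℂ → ℂ) : hcoeff f 0 = f 0 := by simp [hcoeff]

lemma hcoeff_X_pow_mul {f : ℂ → ℂ} (hf : DifferentiableOn ℂ f (ball (0 : ℂ) 1)) (k n : ℕ) :
    hcoeff (fun z => z ^ k * f z) n = if k ≤ n then hcoeff f (n - k) else 0 := by
  rw [hcoeff_mul (f := fun z => z ^ k) (by fun_prop) hf]
  have : ∀ i, hcoeff (fun z => z ^ k) i = if i = k then 1 else 0 := by
    intro i
    have := hcoeff_polynomial (Polynomial.X ^ k) i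
    simpa [Polynomial.coeff_X_pow] using this
  simp only [this, ite_mul, one_mul, zero_mul]
  rw [Finset.Nat.sum_antidiagonal_eq_sum_range_succ_mk]
  simp

lemma hcoeff_sum {ι : Type*} (s : Finset ι) {f : ι → ℂ → ℂ}
    (hf : ∀ i ∈ s, DifferentiableOn ℂ (f i) (ball (0 : ℂ) 1)) (α : ι → ℂ) (n : ℕ) :
    hcoeff (fun z => ∑ i ∈ s, α i * f i z) n = ∑ i ∈ s, α i * hcoeff (f i) n := by
  have h : (fun z => ∑ i ∈ s, α i * f i z) = ∑ i ∈ s, fun z => α i * f i z := by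
    funext z; simp
  rw [hcoeff, h, iteratedDeriv_sum, Finset.sum_div]
  · refine Finset.sum_congr rfl fun i hi => ?_
    rw [iteratedDeriv_const_mul_field, hcoeff, mul_div_assoc]
  · intro i hi
    exact contDiffAt_const.mul (contDiffAt_zero_of_disk (hf i hi) _)

lemma differentiableOn_dslope_zero {f : ℂ → ℂ} (hf : DifferentiableOn ℂ f (ball (0 : ℂ) 1)) :
    DifferentiableOn ℂ (dslope f 0) (ball (0 : ℂ) 1) :=
  (Complex.differentiableOn_dslope (ball_mem_nhds _ one_pos)).2 hf

lemma hcoeff_dslope {f : ℂ → ℂ} (hf : DifferentiableOn ℂ f (ball (0 : ℂ) 1)) (n : ℕ) :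
    hcoeff (dslope f 0) n = hcoeff f (n + 1) := by
  have hd := differentiableOn_dslope_zero hf
  have h1 := hcoeff_X_pow_mul hd 1 (n + 1)
  simp only [le_add_iff_nonneg_left, zero_le, if_true, add_tsub_cancel_right, pow_one] at h1
  rw [← h1]
  have h2 : f = fun z => ∑ i : Fin 2, (1 : ℂ) *
      ((![fun z => z * dslope f 0 z, fun _ => f 0] : Fin 2 → ℂ → ℂ) i z) := by
    funext z
    have := sub_smul_dslope f 0 z
    simp only [sub_zero, smul_eq_mul] at this
    simp [Fin.sum_univ_two, this]
  conv_rhs => rw [h2]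
  rw [hcoeff_sum]
  · have := hcoeff_polynomial (Polynomial.C (f 0)) (n + 1)
    simp only [Polynomial.eval_C, Polynomial.coeff_C, Nat.add_one_ne_zero, if_false] at this
    simp [Fin.sum_univ_two, this]
  · intro i _
    fin_cases i
    · exact differentiableOn_id.mul hd
    · exact differentiableOn_const _

lemma MemHinf.dslope {f : ℂ → ℂ} (hf : MemHinf f) : MemHinf (dslope f 0) := by
  obtain ⟨hd, C, hC⟩ := hf
  have hd' := differentiableOn_dslope_zero hd
  refine ⟨hd', ?_⟩
  obtain ⟨D, hD⟩ := (isCompact_closedBall (0 : ℂ) (1 / 2)).exists_bound_of_continuousOn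
    (hd'.continuousOn.mono (closedBall_subset_ball (by norm_num)))
  refine ⟨max D (4 * C), fun z hz => ?_⟩
  by_cases h : z ∈ closedBall (0 : ℂ) (1 / 2)
  · exact (hD z h).trans (le_max_left _ _)
  · refine le_trans ?_ (le_max_right _ _)
    have hz2 : 1 / 2 < ‖z‖ := by simpa using h
    have h1 := sub_smul_dslope f 0 z
    have h2 : ‖z‖ * ‖_root_.dslope f 0 z‖ = ‖f z - f 0‖ := by
      rw [← h1]; simp
    have h3 : ‖f z - f 0‖ ≤ C + C :=
      (norm_sub_le _ _).trans (add_le_add (hC z hz) (hC 0 (mem_ball_self one_pos)))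
    nlinarith [norm_nonneg (_root_.dslope f 0 z)]

lemma MemHinf.iterate_dslope {f : ℂ → ℂ} (hf : MemHinf f) (k : ℕ) :
    MemHinf ((fun g => _root_.dslope g 0)^[k] f) := by
  induction k with
  | zero => exact hf
  | succ k ih => rw [Function.iterate_succ_apply']; exact ih.dslope

lemma hcoeff_iterate_dslope {f : ℂ → ℂ} (hf : MemHinf f) (k n : ℕ) :
    hcoeff ((fun g => _root_.dslope g 0)^[k] f) n = hcoeff f (n + k) := by
  induction k generalizing n with
  | zero => rfl
  | succ k ih =>
    rw [Function.iterate_succ_apply', hcoeff_dslope (hf.iterate_dslope k).1, ih]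
    congr 1; omega

lemma mem_ball_polar {r : ℝ} (hr : 0 ≤ r) (hr1 : r < 1) (θ : ℝ) :
    (r : ℂ) * Complex.exp ((θ : ℂ) * Complex.I) ∈ ball (0 : ℂ) 1 := by
  simp [Complex.norm_exp_ofReal_mul_I, abs_of_nonneg hr, hr1]

lemma continuous_circle_of_disk {F : ℂ → ℂ} (hF : DifferentiableOn ℂ F (ball (0 : ℂ) 1)) {r : ℝ}
    (hr : 0 ≤ r) (hr1 : r < 1) :
    Continuous fun θ : ℝ => F ((r : ℂ) * Complex.exp ((θ : ℂ) * Complex.I)) :=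
  hF.continuousOn.comp_continuous (by fun_prop) (mem_ball_polar hr hr1)

lemma hasSum_integral_circle {G : ℂ → ℂ} (hG : DifferentiableOn ℂ G (ball (0 : ℂ) 1)) {r : ℝ}
    (hr : 0 ≤ r) (hr1 : r < 1) {K : ℝ → ℂ} (hK : Continuous K) :
    HasSum (fun n => hcoeff G n * (r : ℂ) ^ n *
        ∫ θ in (0 : ℝ)..(2 * Real.pi), K θ * Complex.exp ((θ : ℂ) * Complex.I) ^ n)
      (∫ θ in (0 : ℝ)..(2 * Real.pi), K θ * G ((r : ℂ) * Complex.exp ((θ : ℂ) * Complex.I))) := by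
  have hs : Summable fun n => ‖hcoeff G n * (r : ℂ) ^ n‖ :=
    (hasSum_hcoeff hG (z := r) (by simpa [abs_of_nonneg hr] using hr1)).summable.norm
  have := intervalIntegral.hasSum_integral_of_dominated_convergence (μ := volume)
    (a := 0) (b := 2 * Real.pi)
    (F := fun n θ => hcoeff G n * (r : ℂ) ^ n * (K θ * Complex.exp ((θ : ℂ) * Complex.I) ^ n))
    (f := fun θ => K θ * G ((r : ℂ) * Complex.exp ((θ : ℂ) * Complex.I)))
    (fun n θ => ‖hcoeff G n * (r : ℂ) ^ n‖ * ‖K θ‖) ?_ ?_ ?_ ?_ ?_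
  · simpa only [intervalIntegral.integral_const_mul] using this
  · intro n
    exact (by fun_prop : Continuous _).aestronglyMeasurable
  · intro n
    refine Eventually.of_forall fun θ _ => ?_
    simp [Complex.norm_exp_ofReal_mul_I]
  · exact Eventually.of_forall fun θ _ => hs.mul_right _
  · simp only [tsum_mul_right]
    exact (by fun_prop : Continuous _).intervalIntegrable _ _
  · refine Eventually.of_forall fun θ _ => ?_
    refine (hasSum_congr_fun fun n => ?_).2
      ((hasSum_hcoeff hG (mem_ball_polar hr hr1 θ)).mul_left (K θ))
    rw [mul_pow]; ring

lemma integral_exp_orthogonal (m n : ℕ) :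
    (∫ θ in (0 : ℝ)..(2 * Real.pi), (starRingEnd ℂ) (Complex.exp ((θ : ℂ) * Complex.I) ^ m) *
      Complex.exp ((θ : ℂ) * Complex.I) ^ n) = if n = m then (2 * Real.pi : ℂ) else 0 := by
  have h : ∀ θ : ℝ, (starRingEnd ℂ) (Complex.exp ((θ : ℂ) * Complex.I) ^ m) *
      Complex.exp ((θ : ℂ) * Complex.I) ^ n
      = Complex.exp ((((n : ℤ) - (m : ℤ) : ℤ) * Complex.I) * θ) := by
    intro θ
    rw [map_pow, ← Complex.exp_conj, ← Complex.exp_nat_mul, ← Complex.exp_nat_mul,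
      ← Complex.exp_add]
    congr 1
    simp
    ring
  simp only [h]
  split_ifs with hnm
  · simp [hnm]
  · have hne : (((n : ℤ) - (m : ℤ) : ℤ) : ℂ) ≠ 0 := by
      rw [Int.cast_ne_zero]; omega
    rw [integral_exp_mul_complex (mul_ne_zero hne Complex.I_ne_zero)]
    have h1 : (((n : ℤ) - (m : ℤ) : ℤ) : ℂ) * Complex.I * ((2 * Real.pi : ℝ) : ℂ) =
        ((n : ℤ) - (m : ℤ) : ℤ) * (2 * Real.pi * Complex.I) := by
      push_cast; ring
    rw [h1, Complex.exp_int_mul_two_pi_mul_I]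
    simp

lemma hasSum_parseval {F G : ℂ → ℂ} (hF : DifferentiableOn ℂ F (ball (0 : ℂ) 1))
    (hG : DifferentiableOn ℂ G (ball (0 : ℂ) 1)) {r : ℝ} (hr : 0 ≤ r) (hr1 : r < 1) :
    HasSum (fun n => 2 * (Real.pi : ℂ) * ((starRingEnd ℂ) (hcoeff F n) * hcoeff G n *
        (r : ℂ) ^ (2 * n)))
      (∫ θ in (0 : ℝ)..(2 * Real.pi),
        (starRingEnd ℂ) (F ((r : ℂ) * Complex.exp ((θ : ℂ) * Complex.I))) *
          G ((r : ℂ) * Complex.exp ((θ : ℂ) * Complex.I))) := by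
  have hFc := continuous_circle_of_disk hF hr hr1
  refine (hasSum_congr_fun fun n => ?_).2
    (hasSum_integral_circle hG hr hr1 (Complex.continuous_conj.comp hFc))
  have h1 := hasSum_integral_circle hF hr hr1
    (K := fun θ => (starRingEnd ℂ) (Complex.exp ((θ : ℂ) * Complex.I) ^ n))
    (Complex.continuous_conj.comp (by fun_prop))
  simp only [integral_exp_orthogonal] at h1
  have h2 := h1.unique (hasSum_single n (fun m hm => by simp [hm]))
  simp only [if_true] at h2
  have h3 : (∫ θ in (0 : ℝ)..(2 * Real.pi),
      (starRingEnd ℂ) (F ((r : ℂ) * Complex.exp ((θ : ℂ) * Complex.I))) *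
        Complex.exp ((θ : ℂ) * Complex.I) ^ n) =
      (starRingEnd ℂ) (hcoeff F n * (r : ℂ) ^ n * (2 * Real.pi)) := by
    rw [← h2, intervalIntegral.intervalIntegral_eq_integral_uIoc,
      intervalIntegral.intervalIntegral_eq_integral_uIoc]
    simp only [if_pos Real.two_pi_pos.le, one_smul]
    rw [← integral_conj]
    refine integral_congr_ae (Eventually.of_forall fun θ => ?_)
    simp [mul_comm]
  rw [h3]
  simp only [map_mul, map_pow, Complex.conj_ofReal, map_ofNat]
  ring

/-- The means of `|F|²` over a circle inside the disk, in terms of Taylor coefficients. -/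
lemma hasSum_circle_norm_sq {F : ℂ → ℂ} (hF : DifferentiableOn ℂ F (ball (0 : ℂ) 1)) {r : ℝ}
    (hr : 0 ≤ r) (hr1 : r < 1) :
    HasSum (fun n => 2 * Real.pi * (‖hcoeff F n‖ ^ 2 * r ^ (2 * n)))
      (∫ θ in (0 : ℝ)..(2 * Real.pi),
        ‖F ((r : ℂ) * Complex.exp ((θ : ℂ) * Complex.I))‖ ^ 2) := by
  have h := hasSum_parseval hF hF hr hr1
  simp only [Complex.conj_mul'] at h
  rw [← Complex.hasSum_ofReal, ← intervalIntegral.integral_ofReal]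
  push_cast
  exact h

lemma circle_norm_sq_le {F : ℂ → ℂ} (hF : MemH2 F) {r : ℝ} (hr : 0 ≤ r) (hr1 : r < 1) :
    (∫ θ in (0 : ℝ)..(2 * Real.pi),
      ‖F ((r : ℂ) * Complex.exp ((θ : ℂ) * Complex.I))‖ ^ 2) ≤ 2 * Real.pi * hNormSq F := by
  rw [hNormSq, ← tsum_mul_left]
  refine hasSum_le (fun n => ?_) (hasSum_circle_norm_sq hF.1 hr hr1) (hF.2.mul_left _).hasSum
  have : r ^ (2 * n) ≤ 1 := pow_le_one₀ hr hr1.le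
  have := mul_le_mul_of_nonneg_left this (sq_nonneg ‖hcoeff F n‖)
  have := Real.pi_pos
  gcongr
  linarith

/-- Multiplication by a bounded analytic function preserves `H²`. -/
lemma MemH2.bounded_mul {f g : ℂ → ℂ} (hf : MemHinf f) (hg : MemH2 g) :
    MemH2 fun z => f z * g z := by
  obtain ⟨hfd, C, hC⟩ := hf
  have hd : DifferentiableOn ℂ (fun z => f z * g z) (ball (0 : ℂ) 1) := hfd.mul hg.1
  refine ⟨hd, summable_of_sum_range_le (c := C ^ 2 * hNormSq g) (fun n => sq_nonneg _) ?_⟩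
  intro N
  have key : ∀ r : ℝ, 0 ≤ r → r < 1 →
      ∑ n ∈ Finset.range N, ‖hcoeff (fun z => f z * g z) n‖ ^ 2 * r ^ (2 * n) ≤
        C ^ 2 * hNormSq g := by
    intro r hr hr1
    have h1 := sum_le_hasSum (Finset.range N) (fun n _ => by positivity)
      (hasSum_circle_norm_sq hd hr hr1)
    have h2 : (∫ θ in (0 : ℝ)..(2 * Real.pi),
        ‖f ((r : ℂ) * Complex.exp ((θ : ℂ) * Complex.I)) *
          g ((r : ℂ) * Complex.exp ((θ : ℂ) * Complex.I))‖ ^ 2) ≤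
        ∫ θ in (0 : ℝ)..(2 * Real.pi),
          C ^ 2 * ‖g ((r : ℂ) * Complex.exp ((θ : ℂ) * Complex.I))‖ ^ 2 := by
      refine intervalIntegral.integral_mono_on Real.two_pi_pos.le ?_ ?_ ?_
      · exact ((continuous_circle_of_disk hd hr hr1).norm.pow 2).intervalIntegrable _ _
      · exact (((continuous_circle_of_disk hg.1 hr hr1).norm.pow 2).const_mul
          _).intervalIntegrable _ _
      · intro θ _
        rw [norm_mul, mul_pow]
        gcongr
        exact hC _ (mem_ball_polar hr hr1 θ)
    rw [intervalIntegral.integral_const_mul] at h2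
    have h3 := mul_le_mul_of_nonneg_left (circle_norm_sq_le hg hr hr1) (sq_nonneg C)
    rw [← Finset.mul_sum] at h1
    have h4 := h1.trans (h2.trans h3)
    refine le_of_mul_le_mul_left (h4.trans_eq ?_) Real.two_pi_pos
    ring
  have hlim : Tendsto (fun r : ℝ =>
      ∑ n ∈ Finset.range N, ‖hcoeff (fun z => f z * g z) n‖ ^ 2 * r ^ (2 * n)) (𝓝[<] 1)
      (𝓝 (∑ n ∈ Finset.range N, ‖hcoeff (fun z => f z * g z) n‖ ^ 2 * 1 ^ (2 * n))) :=
    ((by fun_prop : Continuous fun r : ℝ => ∑ n ∈ Finset.range N,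
      ‖hcoeff (fun z => f z * g z) n‖ ^ 2 * r ^ (2 * n)).tendsto 1).mono_left nhdsWithin_le_nhds
  simp only [one_pow, mul_one] at hlim
  refine le_of_tendsto hlim ?_
  filter_upwards [Ioo_mem_nhdsLT zero_lt_one] with r hr using key r hr.1.le hr.2

lemma memH2_polynomial (P : Polynomial ℂ) : MemH2 fun z => P.eval z := by
  refine ⟨P.differentiable.differentiableOn, ?_⟩
  refine summable_of_ne_finset_zero (s := Finset.range (P.natDegree + 1)) fun n hn => ?_
  rw [hcoeff_polynomial, P.coeff_eq_zero_of_natDegree_lt (by simpa [Nat.lt_succ_iff] using hn)]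
  simp

lemma MemHinf.memH2 {f : ℂ → ℂ} (hf : MemHinf f) : MemH2 f := by
  have := MemH2.bounded_mul hf (memH2_polynomial 1)
  simpa using this

lemma summable_norm_conj_mul {a b : ℕ → ℂ} (ha : Summable fun n => ‖a n‖ ^ 2)
    (hb : Summable fun n => ‖b n‖ ^ 2) :
    Summable fun n => ‖(starRingEnd ℂ) (a n) * b n‖ := by
  refine Summable.of_nonneg_of_le (fun _ => norm_nonneg _) (fun n => ?_) (ha.add hb)
  rw [norm_mul, RCLike.norm_conj]
  nlinarith [sq_nonneg (‖a n‖ - ‖b n‖), norm_nonneg (a n), norm_nonneg (b n)]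

lemma IsInner.tendsto_circle_defect {v : ℂ → ℂ} (hv : IsInner v) :
    Tendsto (fun r : ℝ => ∫ θ in (0 : ℝ)..(2 * Real.pi),
      (‖v ((r : ℂ) * Complex.exp ((θ : ℂ) * Complex.I))‖ ^ 2 - 1) ^ 2) (𝓝[<] 1) (𝓝 0) := by
  obtain ⟨⟨hd, C, hC⟩, hae⟩ := hv
  have hmem : Ioo (0 : ℝ) 1 ∈ 𝓝[<] (1 : ℝ) := Ioo_mem_nhdsLT zero_lt_one
  have := intervalIntegral.tendsto_integral_filter_of_dominated_convergence (μ := volume)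
    (a := 0) (b := 2 * Real.pi) (l := 𝓝[<] (1 : ℝ))
    (F := fun (r : ℝ) (θ : ℝ) =>
      (‖v ((r : ℂ) * Complex.exp ((θ : ℂ) * Complex.I))‖ ^ 2 - 1) ^ 2)
    (f := fun _ => (0 : ℝ)) (fun _ => (C ^ 2 + 1) ^ 2) ?_ ?_ ?_ ?_
  · simpa using this
  · filter_upwards [hmem] with r hr
    have := continuous_circle_of_disk hd hr.1.le hr.2
    exact (((this.norm.pow 2).sub continuous_const).pow 2).aestronglyMeasurable
  · filter_upwards [hmem] with r hr
    refine Eventually.of_forall fun θ _ => ?_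
    have h1 := hC _ (mem_ball_polar hr.1.le hr.2 θ)
    have h2 := norm_nonneg (v ((r : ℂ) * Complex.exp ((θ : ℂ) * Complex.I)))
    have h3 : ‖v ((r : ℂ) * Complex.exp ((θ : ℂ) * Complex.I))‖ ^ 2 ≤ C ^ 2 := by gcongr
    rw [Real.norm_of_nonneg (sq_nonneg _)]
    apply sq_le_sq'
    · nlinarith
    · nlinarith
  · exact intervalIntegrable_const
  · filter_upwards [hae] with θ hθ _
    obtain ⟨L, hL, hT⟩ := hθ
    have := ((hT.norm.pow 2).sub_const 1).pow 2
    simpa [hL] using this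

lemma hInner_mul_inner_eq_zero {v h : ℂ → ℂ} (hv : IsInner v) (hh : MemH2 h) (h0 : h 0 = 0) :
    hInner (fun z => v z * h z) v = 0 := by
  have hv2 := hv.1.memH2
  have hvh := hh.bounded_mul hv.1
  have hmem : Ioo (0 : ℝ) 1 ∈ 𝓝[<] (1 : ℝ) := Ioo_mem_nhdsLT zero_lt_one
  set a : ℕ → ℂ := fun n => (starRingEnd ℂ) (hcoeff (fun z => v z * h z) n) * hcoeff v n with ha
  have hlim : Tendsto (fun r : ℝ => ∑' n, a n * (r : ℂ) ^ (2 * n)) (𝓝[<] 1) (𝓝 (∑' n, a n)) := by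
    refine tendsto_tsum_of_dominated_convergence (summable_norm_conj_mul hvh.2 hv2.2) ?_ ?_
    · intro n
      have : Tendsto (fun r : ℝ => a n * (r : ℂ) ^ (2 * n)) (𝓝[<] 1)
          (𝓝 (a n * ((1 : ℝ) : ℂ) ^ (2 * n))) :=
        ((by fun_prop : Continuous fun r : ℝ => a n * (r : ℂ) ^ (2 * n)).tendsto 1).mono_left
          nhdsWithin_le_nhds
      simpa using this
    · filter_upwards [hmem] with r hr n
      rw [norm_mul, norm_pow, Complex.norm_real, Real.norm_of_nonneg hr.1.le]
      exact mul_le_of_le_one_right (norm_nonneg _) (pow_le_one₀ hr.1.le hr.2.le)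
  have hbound : ∀ ε : ℝ, 0 < ε → ∀ r ∈ Ioo (0 : ℝ) 1,
      2 * Real.pi * ‖∑' n, a n * (r : ℂ) ^ (2 * n)‖ ≤ ε * (2 * Real.pi * hNormSq h) +
        ε⁻¹ * ∫ θ in (0 : ℝ)..(2 * Real.pi),
          (‖v ((r : ℂ) * Complex.exp ((θ : ℂ) * Complex.I))‖ ^ 2 - 1) ^ 2 := by
    intro ε hε r hr
    have hvc := continuous_circle_of_disk hv2.1 hr.1.le hr.2
    have hhc := continuous_circle_of_disk hh.1 hr.1.le hr.2
    have hhc' := Complex.continuous_conj.comp hhc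
    simp only [Function.comp_def] at hhc'
    have hw := (hvc.norm.pow 2).sub (continuous_const (y := (1 : ℝ)))
    have hx := (hhc.norm.pow 2).const_mul ε
    have hy := (hw.pow 2).const_mul ε⁻¹
    have h1 := (hasSum_parseval hvh.1 hv2.1 hr.1.le hr.2).tsum_eq
    rw [tsum_mul_left] at h1
    have h2 : (∫ θ in (0 : ℝ)..(2 * Real.pi),
        (starRingEnd ℂ) (h ((r : ℂ) * Complex.exp ((θ : ℂ) * Complex.I)))) = 0 := by
      have h3 := hasSum_parseval (G := fun _ => 1) hh.1 (differentiableOn_const _) hr.1.le hr.2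
      simp only [mul_one] at h3
      refine h3.unique ?_
      rw [hasSum_congr_fun (g := fun _ => 0)]
      · exact hasSum_zero
      · intro n
        have h4 := hcoeff_polynomial 1 n
        simp only [Polynomial.eval_one, Polynomial.coeff_one] at h4
        rw [h4]
        split_ifs with hn
        · rw [hn, hcoeff_zero, h0]; simp
        · simp
    have h5 : (∫ θ in (0 : ℝ)..(2 * Real.pi),
        (starRingEnd ℂ) (v ((r : ℂ) * Complex.exp ((θ : ℂ) * Complex.I)) *
          h ((r : ℂ) * Complex.exp ((θ : ℂ) * Complex.I))) *
          v ((r : ℂ) * Complex.exp ((θ : ℂ) * Complex.I))) =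
        ∫ θ in (0 : ℝ)..(2 * Real.pi),
          (starRingEnd ℂ) (h ((r : ℂ) * Complex.exp ((θ : ℂ) * Complex.I))) *
          ((‖v ((r : ℂ) * Complex.exp ((θ : ℂ) * Complex.I))‖ ^ 2 - 1 : ℝ) : ℂ) := by
      rw [← sub_zero (∫ θ in (0 : ℝ)..(2 * Real.pi),
        (starRingEnd ℂ) (v ((r : ℂ) * Complex.exp ((θ : ℂ) * Complex.I)) *
          h ((r : ℂ) * Complex.exp ((θ : ℂ) * Complex.I))) *
          v ((r : ℂ) * Complex.exp ((θ : ℂ) * Complex.I))), ← h2,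
        ← intervalIntegral.integral_sub]
      · refine intervalIntegral.integral_congr fun θ _ => ?_
        simp only [map_mul]
        push_cast
        rw [← Complex.conj_mul']
        ring
      · exact ((Complex.continuous_conj.comp (hvc.mul hhc)).mul hvc).intervalIntegrable _ _
      · exact hhc'.intervalIntegrable _ _
    have h6 : 2 * Real.pi * ‖∑' n, a n * (r : ℂ) ^ (2 * n)‖ =
        ‖∫ θ in (0 : ℝ)..(2 * Real.pi),
          (starRingEnd ℂ) (h ((r : ℂ) * Complex.exp ((θ : ℂ) * Complex.I))) *
          ((‖v ((r : ℂ) * Complex.exp ((θ : ℂ) * Complex.I))‖ ^ 2 - 1 : ℝ) : ℂ)‖ := by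
      rw [← h5, ← h1, norm_mul]
      simp [ha, abs_of_pos Real.pi_pos]
    rw [h6]
    have h7 := mul_le_mul_of_nonneg_left (circle_norm_sq_le hh hr.1.le hr.2) hε.le
    refine le_trans ?_ (add_le_add_left h7 _)
    rw [← intervalIntegral.integral_const_mul, ← intervalIntegral.integral_const_mul,
      ← intervalIntegral.integral_add]
    · refine (intervalIntegral.norm_integral_le_integral_norm Real.two_pi_pos.le).trans ?_
      refine intervalIntegral.integral_mono_on Real.two_pi_pos.le ?_ ?_ ?_
      · exact (hhc'.mul (Complex.continuous_ofReal.comp hw)).norm.intervalIntegrable _ _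
      · exact (hx.add hy).intervalIntegrable _ _
      · intro θ _
        rw [norm_mul, RCLike.norm_conj, Complex.norm_real, Real.norm_eq_abs]
        generalize ‖h ((r : ℂ) * Complex.exp ((θ : ℂ) * Complex.I))‖ = x
        rw [← sq_abs (‖v ((r : ℂ) * Complex.exp ((θ : ℂ) * Complex.I))‖ ^ 2 - 1)]
        generalize |‖v ((r : ℂ) * Complex.exp ((θ : ℂ) * Complex.I))‖ ^ 2 - 1| = y
        have e1 : ε * x ^ 2 + ε⁻¹ * y ^ 2 - x * y =
            ε * ((x - ε⁻¹ * y / 2) ^ 2) + ε⁻¹ * (3 / 4 * y ^ 2) := by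
          field_simp; ring
        have e2 : 0 ≤ ε * ((x - ε⁻¹ * y / 2) ^ 2) + ε⁻¹ * (3 / 4 * y ^ 2) := by positivity
        linarith
    · exact hx.intervalIntegrable _ _
    · exact hy.intervalIntegrable _ _
  have hfin : ∀ ε : ℝ, 0 < ε → 2 * Real.pi * ‖∑' n, a n‖ ≤ ε * (2 * Real.pi * hNormSq h) := by
    intro ε hε
    have t1 := hlim.norm.const_mul (2 * Real.pi)
    have t2 := (hv.tendsto_circle_defect.const_mul ε⁻¹).const_add (ε * (2 * Real.pi * hNormSq h))
    rw [mul_zero, add_zero] at t2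
    refine le_of_tendsto_of_tendsto t1 t2 ?_
    filter_upwards [hmem] with r hr using hbound ε hε r hr
  have hle : 2 * Real.pi * ‖∑' n, a n‖ ≤ 0 := by
    have t : Tendsto (fun ε : ℝ => ε * (2 * Real.pi * hNormSq h)) (𝓝[>] 0)
        (𝓝 (0 * (2 * Real.pi * hNormSq h))) :=
      (tendsto_id.mul_const _).mono_left nhdsWithin_le_nhds
    rw [zero_mul] at t
    exact ge_of_tendsto t (eventually_mem_nhdsWithin.mono fun ε hε => hfin ε hε)
  have hnorm : ‖∑' n, a n‖ ≤ 0 := by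
    by_contra hcon
    have := mul_pos Real.two_pi_pos (not_le.1 hcon)
    linarith
  exact norm_le_zero_iff.1 hnorm

lemma tsum_conj_mul_shift_inner {v g : ℂ → ℂ} (hv : IsInner v) (hg : MemH2 g) {k : ℕ}
    (hk : 1 ≤ k) :
    ∑' n, (starRingEnd ℂ) (hcoeff (fun z => v z * g z) n) * hcoeff v (n + k) = 0 := by
  have hvg := hg.bounded_mul hv.1
  have hXg : MemH2 fun z => z ^ k * g z := by
    refine MemH2.bounded_mul (f := fun z => z ^ k) ⟨by fun_prop, 1, fun z hz => ?_⟩ hg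
    rw [norm_pow]
    exact pow_le_one₀ (norm_nonneg _) (by simpa using (mem_ball_zero_iff.1 hz).le)
  have h := hInner_mul_inner_eq_zero hv hXg (by simp; left; omega)
  have hfun : (fun z => v z * (z ^ k * g z)) = fun z => z ^ k * (v z * g z) := by
    funext z; ring
  have hs := (summable_norm_conj_mul (hXg.bounded_mul hv.1).2 hv.1.memH2.2).of_norm
  rw [hInner, ← hs.sum_add_tsum_nat_add k] at h
  rw [hfun] at h
  simp only [hcoeff_X_pow_mul hvg.1] at h
  rw [Finset.sum_eq_zero] at h
  · simpa using h
  · intro i hi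
    rw [if_neg (by simpa using hi)]
    simp

/-- An `H²` function whose coefficient sequence is a combination of proper backward shifts of the
coefficient sequence of the inner function `v` lies in `K_v`. -/
lemma mem_KSpace_of_hcoeff {v f : ℂ → ℂ} (hv : IsInner v) (hf : MemH2 f) {ι : Type*} [Fintype ι]
    (α : ι → ℂ) (k : ι → ℕ) (hk : ∀ i, 1 ≤ k i)
    (hc : ∀ n, hcoeff f n = ∑ i, α i * hcoeff v (n + k i)) : f ∈ KSpace v := by
  refine ⟨hf, fun g hg => ?_⟩
  have hvg := hg.bounded_mul hv.1
  have h1 : ∀ n, (starRingEnd ℂ) (hcoeff (fun z => v z * g z) n) * hcoeff f n =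
      ∑ i, α i * ((starRingEnd ℂ) (hcoeff (fun z => v z * g z) n) * hcoeff v (n + k i)) := by
    intro n
    rw [hc, Finset.mul_sum]
    exact Finset.sum_congr rfl fun i _ => by ring
  rw [hInner]
  simp only [h1]
  rw [Summable.tsum_finsetSum]
  · refine Finset.sum_eq_zero fun i _ => ?_
    rw [tsum_mul_left, tsum_conj_mul_shift_inner hv hg (hk i), mul_zero]
  · intro i _
    exact (summable_norm_conj_mul hvg.2
      ((summable_nat_add_iff (k i)).2 hv.1.memH2.2)).of_norm.mul_left _

lemma one_sub_conj_mul_ne_zero {a z : ℂ} (ha : ‖a‖ < 1) (hz : ‖z‖ ≤ 1) :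
    1 - (starRingEnd ℂ) a * z ≠ 0 := by
  intro h
  have h1 : (starRingEnd ℂ) a * z = 1 := (sub_eq_zero.1 h).symm
  have h2 : ‖a‖ * ‖z‖ = 1 := by rw [← RCLike.norm_conj a, ← norm_mul, h1, norm_one]
  nlinarith [norm_nonneg a, norm_nonneg z]

lemma norm_one_sub_conj_mul {a z : ℂ} (hz : ‖z‖ = 1) :
    ‖1 - (starRingEnd ℂ) a * z‖ = ‖z - a‖ := by
  have h : z * (starRingEnd ℂ) (z - a) = 1 - (starRingEnd ℂ) a * z := by
    rw [map_sub, mul_sub, Complex.mul_conj', hz]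
    push_cast
    ring
  rw [← h, norm_mul, hz, one_mul, RCLike.norm_conj]

/-- Up to a unimodular constant, a Blaschke factor is `(z - a) / (1 - conj a * z)`. -/
lemma exists_blaschkeFactor_eq (a : ℂ) :
    ∃ c : ℂ, ‖c‖ = 1 ∧ ∀ z, (z - a) / (1 - (starRingEnd ℂ) a * z) = c * blaschkeFactor a z := by
  by_cases ha : a = 0
  · exact ⟨1, norm_one, fun z => by simp [blaschkeFactor, ha]⟩
  · have hn : (‖a‖ : ℂ) ≠ 0 := by simpa using ha
    refine ⟨-(a / ‖a‖), ?_, fun z => ?_⟩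
    · rw [norm_neg, norm_div, Complex.norm_real, norm_norm, div_self (by simpa using ha)]
    · rw [blaschkeFactor, if_neg ha]
      field_simp
      ring

lemma IsFiniteBlaschke.factor_mul {F G : ℂ → ℂ} (hG : IsFiniteBlaschke G) {a : ℂ}
    (ha : a ∈ ball (0 : ℂ) 1)
    (hF : ∀ z ∈ ball (0 : ℂ) 1, F z = (z - a) / (1 - (starRingEnd ℂ) a * z) * G z) :
    IsFiniteBlaschke F := by
  obtain ⟨c, N, b, hc, hb, hGz⟩ := hG
  obtain ⟨d, hd, hdz⟩ := exists_blaschkeFactor_eq a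
  refine ⟨d * c, N + 1, Fin.cons a b, by rw [norm_mul, hd, hc, one_mul], ?_, ?_⟩
  · intro i
    refine Fin.cases ?_ ?_ i
    · simpa using ha
    · intro j; simpa using hb j
  · intro z hz
    rw [hF z hz, hGz z hz, hdz, Fin.prod_univ_succ]
    simp only [Fin.cons_zero, Fin.cons_succ]
    ring

lemma isFiniteBlaschke_of_ne_zero {F : ℂ → ℂ} (hF : DiffContOnCl ℂ F (ball (0 : ℂ) 1))
    (h0 : ∀ z ∈ closedBall (0 : ℂ) 1, F z ≠ 0) (h1 : ∀ z, ‖z‖ = 1 → ‖F z‖ = 1) :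
    IsFiniteBlaschke F := by
  have hcl : closure (ball (0 : ℂ) 1) = closedBall 0 1 := closure_ball _ one_ne_zero
  have hfr : frontier (ball (0 : ℂ) 1) = sphere 0 1 := frontier_ball _ one_ne_zero
  have hle : ∀ z ∈ closedBall (0 : ℂ) 1, ‖F z‖ ≤ 1 := by
    intro z hz
    refine Complex.norm_le_of_forall_mem_frontier_norm_le isBounded_ball hF ?_ (hcl ▸ hz)
    intro w hw
    rw [hfr] at hw
    exact (h1 w (by simpa using hw)).le
  have hge : ∀ z ∈ closedBall (0 : ℂ) 1, 1 ≤ ‖F z‖ := by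
    intro z hz
    have hinv : DiffContOnCl ℂ F⁻¹ (ball (0 : ℂ) 1) := hF.inv (fun w hw => h0 w (hcl ▸ hw))
    have := Complex.norm_le_of_forall_mem_frontier_norm_le (C := 1) isBounded_ball hinv ?_
      (z := z) (hcl ▸ hz)
    · rw [Pi.inv_apply, norm_inv] at this
      exact (inv_le_one₀ (norm_pos_iff.2 (h0 z hz))).1 this
    · intro w hw
      rw [hfr] at hw
      rw [Pi.inv_apply, norm_inv, h1 w (by simpa using hw), inv_one]
  have hconst := Complex.eqOn_of_isPreconnected_of_isMaxOn_norm
    (convex_ball (0 : ℂ) 1).isPreconnected isOpen_ball hF.differentiableOn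
    (mem_ball_self one_pos) (fun z hz =>
      (hle z (ball_subset_closedBall hz)).trans (hge 0 (mem_closedBall_self zero_le_one)))
  refine ⟨F 0, 0, Fin.elim0, le_antisymm (hle 0 (mem_closedBall_self zero_le_one))
    (hge 0 (mem_closedBall_self zero_le_one)), fun i => i.elim0, fun z hz => ?_⟩
  simpa using hconst hz

lemma isFiniteBlaschke_polynomial_mul (n : ℕ) (P : Polynomial ℂ) (hn : P.natDegree = n)
    (W : ℂ → ℂ) (hW : DiffContOnCl ℂ W (ball (0 : ℂ) 1))
    (hW0 : ∀ z ∈ closedBall (0 : ℂ) 1, W z ≠ 0)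
    (h1 : ∀ z, ‖z‖ = 1 → ‖P.eval z * W z‖ = 1) :
    IsFiniteBlaschke fun z => P.eval z * W z := by
  induction n generalizing P W with
  | zero =>
    have hP : P = Polynomial.C (P.coeff 0) := Polynomial.eq_C_of_natDegree_eq_zero hn
    refine isFiniteBlaschke_of_ne_zero (P.differentiable.diffContOnCl.smul hW) ?_ h1
    intro z hz
    refine mul_ne_zero ?_ (hW0 z hz)
    have := h1 1 norm_one
    rw [hP, Polynomial.eval_C] at this ⊢
    intro h
    rw [h] at this
    simp at this
  | succ n ih =>
    by_cases hroot : ∃ a ∈ ball (0 : ℂ) 1, P.IsRoot a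
    · obtain ⟨a, ha, hPa⟩ := hroot
      have ha1 : ‖a‖ < 1 := by simpa using ha
      obtain ⟨P', rfl⟩ := Polynomial.dvd_iff_isRoot.2 hPa
      have hP'0 : P' ≠ 0 := by rintro rfl; simp at hn
      rw [Polynomial.natDegree_mul (Polynomial.X_sub_C_ne_zero a) hP'0,
        Polynomial.natDegree_X_sub_C] at hn
      have hlin : Differentiable ℂ fun z => 1 - (starRingEnd ℂ) a * z := by fun_prop
      refine (ih P' (by omega) (fun z => (1 - (starRingEnd ℂ) a * z) * W z)
        (hlin.diffContOnCl.smul hW) ?_ ?_).factor_mul ha ?_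
      · intro z hz
        exact mul_ne_zero (one_sub_conj_mul_ne_zero ha1 (by simpa using hz)) (hW0 z hz)
      · intro z hz
        have := h1 z hz
        simp only [Polynomial.eval_mul, Polynomial.eval_sub, Polynomial.eval_X, Polynomial.eval_C,
          norm_mul] at this
        rw [norm_mul, norm_mul, norm_one_sub_conj_mul hz, ← this]
        ring
      · intro z hz
        have hz1 : ‖z‖ ≤ 1 := by simpa using (mem_ball_zero_iff.1 hz).le
        have := one_sub_conj_mul_ne_zero ha1 hz1
        simp only [Polynomial.eval_mul, Polynomial.eval_sub, Polynomial.eval_X, Polynomial.eval_C]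
        rw [div_mul_eq_mul_div, eq_div_iff this]
        ring
    · push Not at hroot
      refine isFiniteBlaschke_of_ne_zero (P.differentiable.diffContOnCl.smul hW) ?_ h1
      intro z hz
      refine mul_ne_zero ?_ (hW0 z hz)
      rcases (mem_closedBall_zero_iff.1 hz).lt_or_eq with h | h
      · exact hroot z (by simpa using h)
      · intro h2
        have := h1 z h
        rw [h2] at this
        simp at this

/-- A rational inner function whose denominator does not vanish on the closed disk is a finite
Blaschke product. -/
lemma IsInner.isFiniteBlaschke_of_denominator_ne_zero {v : ℂ → ℂ} (hv : IsInner v)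
    (R P : Polynomial ℂ) (hR : ∀ z ∈ closedBall (0 : ℂ) 1, R.eval z ≠ 0)
    (h : ∀ z ∈ ball (0 : ℂ) 1, R.eval z * v z = P.eval z) : IsFiniteBlaschke v := by
  have hcl : closure (ball (0 : ℂ) 1) = closedBall 0 1 := closure_ball _ one_ne_zero
  have hW : DiffContOnCl ℂ (fun z => R.eval z)⁻¹ (ball (0 : ℂ) 1) :=
    R.differentiable.diffContOnCl.inv (fun w hw => hR w (hcl ▸ hw))
  have hvz : ∀ z ∈ ball (0 : ℂ) 1, v z = P.eval z * (fun z => R.eval z)⁻¹ z := by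
    intro z hz
    rw [← h z hz, Pi.inv_apply]
    field_simp [hR z (ball_subset_closedBall hz)]
  have hcirc : ∀ θ : ℝ, R.eval (Complex.exp ((θ : ℂ) * Complex.I)) ≠ 0 := fun θ =>
    hR _ (by simp [Complex.norm_exp_ofReal_mul_I])
  have hcont : Continuous fun θ : ℝ => ‖P.eval (Complex.exp ((θ : ℂ) * Complex.I)) *
      (R.eval (Complex.exp ((θ : ℂ) * Complex.I)))⁻¹‖ := by
    have h1 : Continuous fun θ : ℝ => P.eval (Complex.exp ((θ : ℂ) * Complex.I)) :=
      P.continuous.comp (by fun_prop)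
    have h2 : Continuous fun θ : ℝ => R.eval (Complex.exp ((θ : ℂ) * Complex.I)) :=
      R.continuous.comp (by fun_prop)
    exact (h1.mul (h2.inv₀ hcirc)).norm
  have hone : (fun θ : ℝ => ‖P.eval (Complex.exp ((θ : ℂ) * Complex.I)) *
      (R.eval (Complex.exp ((θ : ℂ) * Complex.I)))⁻¹‖) = fun _ => 1 := by
    refine (hcont.ae_eq_iff_eq volume continuous_const).1 ?_
    filter_upwards [hv.2] with θ hθ
    obtain ⟨L, hL, hT⟩ := hθ
    have hray : Tendsto (fun r : ℝ => (r : ℂ) * Complex.exp ((θ : ℂ) * Complex.I)) (𝓝[<] 1)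
        (𝓝 (Complex.exp ((θ : ℂ) * Complex.I))) := by
      have : Tendsto (fun r : ℝ => (r : ℂ) * Complex.exp ((θ : ℂ) * Complex.I)) (𝓝[<] 1)
          (𝓝 (((1 : ℝ) : ℂ) * Complex.exp ((θ : ℂ) * Complex.I))) :=
        ((by fun_prop : Continuous fun r : ℝ =>
          (r : ℂ) * Complex.exp ((θ : ℂ) * Complex.I)).tendsto 1).mono_left nhdsWithin_le_nhds
      simpa using this
    have hlim := ((P.continuous.tendsto _).comp hray).mul
      (((R.continuous.tendsto _).comp hray).inv₀ (hcirc θ))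
    have hT' : Tendsto (fun r : ℝ => v ((r : ℂ) * Complex.exp ((θ : ℂ) * Complex.I))) (𝓝[<] 1)
        (𝓝 (P.eval (Complex.exp ((θ : ℂ) * Complex.I)) *
          (R.eval (Complex.exp ((θ : ℂ) * Complex.I)))⁻¹)) := by
      refine hlim.congr' ?_
      filter_upwards [Ioo_mem_nhdsLT zero_lt_one] with r hr
      exact (hvz _ (mem_ball_polar hr.1.le hr.2 θ)).symm
    rw [← tendsto_nhds_unique hT hT', hL]
  obtain ⟨c, N, a, hc, ha, hB⟩ := isFiniteBlaschke_polynomial_mul _ P rfl _ hW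
    (fun z hz => inv_ne_zero (hR z hz)) (fun z hz => by
      obtain ⟨θ, hθ⟩ : ∃ θ : ℝ, Complex.exp ((θ : ℂ) * Complex.I) = z :=
        ⟨z.arg, by simpa [hz] using Complex.norm_mul_exp_arg_mul_I z⟩
      have := congrFun hone θ
      rw [hθ] at this
      exact this)
  exact ⟨c, N, a, hc, ha, fun z hz => (hvz z hz).trans (hB z hz)⟩

/-- A rational inner function is a finite Blaschke product. -/
lemma IsInner.isFiniteBlaschke_of_rational {v : ℂ → ℂ} (hv : IsInner v) (n : ℕ)
    (R P : Polynomial ℂ) (hn : R.natDegree = n) (hR : R ≠ 0)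
    (h : ∀ z ∈ ball (0 : ℂ) 1, R.eval z * v z = P.eval z) : IsFiniteBlaschke v := by
  induction n generalizing R P with
  | zero =>
    have hC : R = Polynomial.C (R.coeff 0) := Polynomial.eq_C_of_natDegree_eq_zero hn
    refine hv.isFiniteBlaschke_of_denominator_ne_zero R P (fun z _ => ?_) h
    rw [hC, Polynomial.eval_C]
    intro h0
    rw [h0, Polynomial.C_0] at hC
    exact hR hC
  | succ n ih =>
    by_cases hroot : ∃ a ∈ closedBall (0 : ℂ) 1, R.IsRoot a
    · obtain ⟨a, ha, hRa⟩ := hroot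
      obtain ⟨C, hC⟩ := hv.1.2
      have hPa : P.IsRoot a := by
        have hle : ∀ z ∈ closedBall (0 : ℂ) 1, ‖P.eval z‖ ≤ C * ‖R.eval z‖ := by
          rw [← closure_ball (0 : ℂ) one_ne_zero]
          intro z hz
          refine le_on_closure (s := ball (0 : ℂ) 1) (f := fun z => ‖P.eval z‖)
            (g := fun z => C * ‖R.eval z‖) ?_ P.continuous.norm.continuousOn
            (R.continuous.norm.const_mul C).continuousOn hz
          intro w hw
          rw [← h w hw, norm_mul, mul_comm]
          exact mul_le_mul_of_nonneg_right (hC w hw) (norm_nonneg _)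
        have := hle a ha
        rw [hRa.eq_zero] at this
        simpa using this
      obtain ⟨R', rfl⟩ := Polynomial.dvd_iff_isRoot.2 hRa
      obtain ⟨P', rfl⟩ := Polynomial.dvd_iff_isRoot.2 hPa
      have hR'0 : R' ≠ 0 := right_ne_zero_of_mul hR
      rw [Polynomial.natDegree_mul (Polynomial.X_sub_C_ne_zero a) hR'0,
        Polynomial.natDegree_X_sub_C] at hn
      refine ih R' P' (by omega) hR'0 ?_
      have hoff : ∀ z ∈ ball (0 : ℂ) 1, z ≠ a → R'.eval z * v z = P'.eval z := by
        intro z hz hza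
        have := h z hz
        simp only [Polynomial.eval_mul, Polynomial.eval_sub, Polynomial.eval_X,
          Polynomial.eval_C, mul_assoc] at this
        exact mul_left_cancel₀ (sub_ne_zero.2 hza) this
      intro z hz
      by_cases hza : z = a
      · have hc1 : ContinuousAt (fun w => R'.eval w * v w) z :=
          R'.continuous.continuousAt.mul
            ((hv.1.1.differentiableAt (isOpen_ball.mem_nhds hz)).continuousAt)
        have hc2 : ContinuousAt (fun w => P'.eval w) z := P'.continuous.continuousAt
        have t1 : Tendsto (fun w => R'.eval w * v w) (𝓝[≠] z) (𝓝 (R'.eval z * v z)) :=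
          hc1.mono_left nhdsWithin_le_nhds
        have t2 : Tendsto (fun w => P'.eval w) (𝓝[≠] z) (𝓝 (P'.eval z)) :=
          hc2.mono_left nhdsWithin_le_nhds
        refine tendsto_nhds_unique (t1.congr' ?_) t2
        filter_upwards [self_mem_nhdsWithin, mem_nhdsWithin_of_mem_nhds (isOpen_ball.mem_nhds hz)]
          with w hw1 hw2
        exact hoff w hw2 (hza ▸ hw1)
      · exact hoff z hz hza
    · push Not at hroot
      exact hv.isFiniteBlaschke_of_denominator_ne_zero R P hroot h

lemma eqOn_sum_of_hcoeff_eq_zero {f : ℂ → ℂ} (hf : DifferentiableOn ℂ f (ball (0 : ℂ) 1)) {N : ℕ}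
    (h : ∀ n, N ≤ n → hcoeff f n = 0) {z : ℂ} (hz : z ∈ ball (0 : ℂ) 1) :
    f z = ∑ i : Fin N, hcoeff f i * z ^ (i : ℕ) := by
  rw [Fin.sum_univ_eq_sum_range (fun i => hcoeff f i * z ^ i) N]
  refine (hasSum_hcoeff hf hz).unique (hasSum_sum_of_ne_finset_zero fun n hn => ?_)
  rw [h n (by simpa using hn), zero_mul]

lemma reverse_X_sub_C (b : ℂ) :
    (Polynomial.X - Polynomial.C b).reverse = 1 - Polynomial.C b * Polynomial.X := by
  have h : (1 : Polynomial ℂ).reflect 1 = Polynomial.X := by simp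
  have h' : (Polynomial.X : Polynomial ℂ).reflect 1 = 1 := by simp
  rw [Polynomial.reverse, Polynomial.natDegree_X_sub_C, Polynomial.reflect_sub, h',
    Polynomial.reflect_C, pow_one]

lemma reverse_prod_X_sub_C {ι : Type*} (s : Finset ι) (b : ι → ℂ) :
    (∏ i ∈ s, (Polynomial.X - Polynomial.C (b i))).reverse =
      ∏ i ∈ s, (1 - Polynomial.C (b i) * Polynomial.X) := by
  classical
  induction s using Finset.induction_on with
  | empty => simpa using Polynomial.reverse_C (1 : ℂ)
  | insert i s hi ih =>
    rw [Finset.prod_insert hi, Finset.prod_insert hi, Polynomial.reverse_mul_of_domain, ih,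
      reverse_X_sub_C]

/-- The numerator and the denominator of a Blaschke product have conjugate, reversed
coefficients. -/
lemma coeff_prod_one_sub_conj {N : ℕ} (a : Fin N → ℂ) (i : ℕ) :
    (∏ j, (1 - Polynomial.C ((starRingEnd ℂ) (a j)) * Polynomial.X)).coeff i =
      if i ≤ N then (starRingEnd ℂ) ((∏ j, (Polynomial.X - Polynomial.C (a j))).coeff (N - i))
      else 0 := by
  have hmap : (∏ j, (Polynomial.X - Polynomial.C (a j))).map (starRingEnd ℂ) =
      ∏ j, (Polynomial.X - Polynomial.C ((starRingEnd ℂ) (a j))) := by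
    rw [Polynomial.map_prod]
    simp
  have hdeg : (∏ j, (Polynomial.X - Polynomial.C ((starRingEnd ℂ) (a j)))).natDegree = N := by
    rw [Polynomial.natDegree_prod_of_monic _ _ fun j _ => Polynomial.monic_X_sub_C _]
    simp
  rw [← reverse_prod_X_sub_C, Polynomial.coeff_reverse, hdeg]
  split_ifs with hi
  · rw [Polynomial.revAt_le hi, ← hmap, Polynomial.coeff_map]
  · rw [Polynomial.revAt_eq_self_of_lt (not_le.1 hi)]
    exact Polynomial.coeff_eq_zero_of_natDegree_lt (by rw [hdeg]; exact not_le.1 hi)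

lemma exists_blaschke_mul_denominator {u : ℂ → ℂ} {c : ℂ} {N : ℕ} {a : Fin N → ℂ} (hc : ‖c‖ = 1)
    (ha : ∀ i, a i ∈ ball (0 : ℂ) 1)
    (hu : ∀ z ∈ ball (0 : ℂ) 1, u z = c * ∏ i, blaschkeFactor (a i) z) :
    ∃ d : ℂ, d ≠ 0 ∧ ∀ z ∈ ball (0 : ℂ) 1,
      u z * (∏ j, (1 - Polynomial.C ((starRingEnd ℂ) (a j)) * Polynomial.X)).eval z =
        d * (∏ j, (Polynomial.X - Polynomial.C (a j))).eval z := by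
  choose e he hez using fun i => exists_blaschkeFactor_eq (a i)
  have hene : ∀ i, e i ≠ 0 := fun i => norm_ne_zero_iff.1 (by rw [he i]; exact one_ne_zero)
  have hcne : c ≠ 0 := norm_ne_zero_iff.1 (by rw [hc]; exact one_ne_zero)
  refine ⟨c * ∏ i, (e i)⁻¹, mul_ne_zero hcne
    (Finset.prod_ne_zero_iff.2 fun i _ => inv_ne_zero (hene i)), fun z hz => ?_⟩
  rw [hu z hz, Polynomial.eval_prod, Polynomial.eval_prod, mul_assoc, mul_assoc,
    ← Finset.prod_mul_distrib, ← Finset.prod_mul_distrib]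
  congr 1
  refine Finset.prod_congr rfl fun i _ => ?_
  have h1 := one_sub_conj_mul_ne_zero (a := a i) (z := z) (by simpa using ha i)
    (by simpa using (mem_ball_zero_iff.1 hz).le)
  have h2 := hez i z
  rw [div_eq_iff h1] at h2
  simp only [Polynomial.eval_sub, Polynomial.eval_one, Polynomial.eval_mul, Polynomial.eval_C,
    Polynomial.eval_X]
  rw [h2]
  field_simp [hene i]

/-- For a Blaschke product of degree `N`, multiplication by the denominator maps the model space
into polynomials of degree less than `N`. -/
lemma hcoeff_denominator_mul_eq_zero {u f : ℂ → ℂ} {c : ℂ} {N : ℕ} {a : Fin N → ℂ} (hc : ‖c‖ = 1)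
    (ha : ∀ i, a i ∈ ball (0 : ℂ) 1)
    (hu : ∀ z ∈ ball (0 : ℂ) 1, u z = c * ∏ i, blaschkeFactor (a i) z) (hf : f ∈ KSpace u)
    {n : ℕ} (hn : N ≤ n) :
    hcoeff (fun z =>
      (∏ j, (1 - Polynomial.C ((starRingEnd ℂ) (a j)) * Polynomial.X)).eval z * f z) n = 0 := by
  obtain ⟨d, hd, huQ⟩ := exists_blaschke_mul_denominator hc ha hu
  obtain ⟨k, rfl⟩ := Nat.exists_eq_add_of_le hn
  set Q : Polynomial ℂ := ∏ j, (1 - Polynomial.C ((starRingEnd ℂ) (a j)) * Polynomial.X) with hQ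
  set P : Polynomial ℂ := ∏ j, (Polynomial.X - Polynomial.C (a j)) with hP
  have hdeg : P.natDegree = N := by
    rw [hP, Polynomial.natDegree_prod_of_monic _ _ fun j _ => Polynomial.monic_X_sub_C _]
    simp
  have horth := hf.2 _ (memH2_polynomial (Q * Polynomial.X ^ k))
  have hcoef : ∀ m, hcoeff (fun z => u z * (Q * Polynomial.X ^ k).eval z) m =
      d * (P * Polynomial.X ^ k).coeff m := by
    intro m
    rw [← Polynomial.coeff_C_mul, ← hcoeff_polynomial]
    refine hcoeff_congr (fun z hz => ?_) m
    simp only [Polynomial.eval_mul, Polynomial.eval_C]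
    rw [← mul_assoc, huQ z hz, mul_assoc]
  rw [hInner] at horth
  simp only [hcoef, Polynomial.coeff_mul_X_pow'] at horth
  rw [tsum_eq_sum (s := Finset.range (N + k + 1))] at horth
  · rw [hcoeff_mul Q.differentiable.differentiableOn hf.1.1,
      Finset.Nat.sum_antidiagonal_eq_sum_range_succ_mk, ← Finset.sum_range_reflect]
    have hd' : (starRingEnd ℂ) d ≠ 0 := by simpa using hd
    rw [← mul_right_inj' hd', mul_zero, Finset.mul_sum, ← horth]
    refine Finset.sum_congr rfl fun m hm => ?_
    have hm' : m ≤ N + k := Nat.lt_succ_iff.1 (Finset.mem_range.1 hm)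
    simp only [hcoeff_polynomial]
    have e1 : N + k + 1 - 1 - m = N + k - m := by omega
    rw [e1, hQ, coeff_prod_one_sub_conj, ← hP]
    have e2 : N + k - (N + k - m) = m := by omega
    rw [e2, map_mul]
    by_cases hkm : k ≤ m
    · have e3 : N - (N + k - m) = m - k := by omega
      rw [if_pos (by omega), if_pos hkm, e3, mul_assoc]
    · rw [if_neg (by omega), if_neg hkm]
      simp
  · intro m hm
    have hm' : N + k < m := by simpa [Nat.lt_succ_iff] using hm
    rw [if_pos (by omega), P.coeff_eq_zero_of_natDegree_lt (by omega)]
    simp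

lemma MemHinf.sum {ι : Type*} [Fintype ι] {f : ι → ℂ → ℂ} (hf : ∀ i, MemHinf (f i)) (α : ι → ℂ) :
    MemHinf fun z => ∑ i, α i * f i z := by
  choose C hC using fun i => (hf i).2
  refine ⟨DifferentiableOn.fun_sum fun i _ => (hf i).1.const_mul _, ∑ i, ‖α i‖ * C i,
    fun z hz => (norm_sum_le _ _).trans (Finset.sum_le_sum fun i _ => ?_)⟩
  rw [norm_mul]
  exact mul_le_mul_of_nonneg_left (hC i z hz) (norm_nonneg _)

lemma memHinf_polynomial (P : Polynomial ℂ) : MemHinf fun z => P.eval z := by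
  refine ⟨P.differentiable.differentiableOn, ?_⟩
  obtain ⟨C, hC⟩ := (isCompact_closedBall (0 : ℂ) 1).exists_bound_of_continuousOn
    P.continuous.continuousOn
  exact ⟨C, fun z hz => hC z (ball_subset_closedBall hz)⟩

lemma MemHinf.mul {f g : ℂ → ℂ} (hf : MemHinf f) (hg : MemHinf g) :
    MemHinf fun z => f z * g z := by
  obtain ⟨hfd, C, hC⟩ := hf
  obtain ⟨hgd, D, hD⟩ := hg
  refine ⟨hfd.mul hgd, C * D, fun z hz => ?_⟩
  rw [norm_mul]
  exact mul_le_mul (hC z hz) (hD z hz) (norm_nonneg _) ((norm_nonneg _).trans (hC z hz))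

/-- For `v` inner and not a finite Blaschke product there is a nonzero bounded `ψ` such that
`z ^ i * ψ` lies in the span of the backward shifts of `v` for all `i ≤ N`. -/
lemma exists_bounded_shift_combination {v : ℂ → ℂ} (hv : IsInner v) (hvinf : ¬ IsFiniteBlaschke v)
    (N : ℕ) :
    ∃ (ψ : ℂ → ℂ) (α : Fin (N + 1) → ℂ), MemHinf ψ ∧ (∃ z ∈ ball (0 : ℂ) 1, ψ z ≠ 0) ∧
      ∀ i ≤ N, ∀ n, hcoeff (fun z => z ^ i * ψ z) n =
        ∑ j, α j * hcoeff v (n + ((j : ℕ) + 1 + (N - i))) := by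
  obtain ⟨α, hα, hα0⟩ : ∃ α : Fin (N + 1) → ℂ,
      (∀ n < N, ∑ j, α j * hcoeff v (n + ((j : ℕ) + 1)) = 0) ∧ α ≠ 0 := by
    let M : Matrix (Fin N) (Fin (N + 1)) ℂ := Matrix.of fun n j => hcoeff v (n + ((j : ℕ) + 1))
    have hker := LinearMap.ker_ne_bot_of_finrank_lt (f := M.mulVecLin) (by simp)
    obtain ⟨α, hα, hα0⟩ := Submodule.exists_mem_ne_zero_of_ne_bot hker
    refine ⟨α, fun n hn => ?_, hα0⟩
    have := congrFun (LinearMap.mem_ker.1 hα) ⟨n, hn⟩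
    simp only [Matrix.mulVecLin_apply, Matrix.mulVec, dotProduct, M, Matrix.of_apply,
      Pi.zero_apply] at this
    rw [← this]
    exact Finset.sum_congr rfl fun j _ => mul_comm _ _
  have hB := fun j : Fin (N + 1) => hv.1.iterate_dslope ((j : ℕ) + 1 + N)
  set ψ : ℂ → ℂ := fun z => ∑ j : Fin (N + 1),
    α j * ((fun g => _root_.dslope g 0)^[(j : ℕ) + 1 + N] v) z with hψ
  have hψb : MemHinf ψ := MemHinf.sum hB α
  have hψc : ∀ n, hcoeff ψ n = ∑ j, α j * hcoeff v (n + ((j : ℕ) + 1 + N)) := by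
    intro n
    rw [hψ, hcoeff_sum _ fun j _ => (hB j).1]
    simp only [hcoeff_iterate_dslope hv.1]
  refine ⟨ψ, α, hψb, ?_, ?_⟩
  · by_contra! hzero
    have hall : ∀ n, ∑ j, α j * hcoeff v (n + ((j : ℕ) + 1)) = 0 := by
      intro n
      rcases lt_or_ge n N with hn | hn
      · exact hα n hn
      · obtain ⟨m, rfl⟩ := Nat.exists_eq_add_of_le' hn
        have h0 : hcoeff ψ m = 0 := by
          rw [hcoeff_congr (g := fun z => (0 : Polynomial ℂ).eval z)
            (fun z hz => by simpa using hzero z hz), hcoeff_polynomial, Polynomial.coeff_zero]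
        rw [← h0, hψc]
        refine Finset.sum_congr rfl fun j _ => ?_
        congr 2; omega
    set R : Polynomial ℂ := ∑ j : Fin (N + 1), Polynomial.C (α j) * Polynomial.X ^ (N - (j : ℕ))
      with hR
    have hReval : ∀ z, R.eval z * v z = ∑ j : Fin (N + 1), α j * (z ^ (N - (j : ℕ)) * v z) := by
      intro z
      rw [hR, Polynomial.eval_finsetSum, Finset.sum_mul]
      simp [mul_assoc]
    have hR0 : R ≠ 0 := by
      intro hzero
      refine hα0 (funext fun i => ?_)
      have h1 : R.coeff (N - i) = α i := by
        rw [hR, Polynomial.finsetSum_coeff, Finset.sum_eq_single i]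
        · simp
        · intro j _ hj
          rw [Polynomial.coeff_C_mul, Polynomial.coeff_X_pow, if_neg, mul_zero]
          intro h
          apply hj
          ext
          omega
        · simp
      rw [← h1, hzero]
      simp
    have hRd : DifferentiableOn ℂ (fun z => R.eval z * v z) (ball (0 : ℂ) 1) :=
      R.differentiable.differentiableOn.mul hv.1.1
    have hvan : ∀ n, N + 1 ≤ n → hcoeff (fun z => R.eval z * v z) n = 0 := by
      intro n hn
      obtain ⟨m, rfl⟩ := Nat.exists_eq_add_of_le' hn
      rw [funext hReval, hcoeff_sum (f := fun (j : Fin (N + 1)) z => z ^ (N - (j : ℕ)) * v z) _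
        fun j _ => (by fun_prop : DifferentiableOn ℂ (fun z : ℂ => z ^ (N - (j : ℕ))) _).mul hv.1.1,
        ← hall m]
      refine Finset.sum_congr rfl fun j _ => ?_
      rw [hcoeff_X_pow_mul hv.1.1, if_pos (by omega)]
      congr 2; omega
    refine hvinf (hv.isFiniteBlaschke_of_rational _ R (∑ i : Fin (N + 1),
      Polynomial.C (hcoeff (fun z => R.eval z * v z) i) * Polynomial.X ^ (i : ℕ)) rfl hR0 ?_)
    intro z hz
    rw [eqOn_sum_of_hcoeff_eq_zero hRd hvan hz, Polynomial.eval_finsetSum]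
    simp
  · intro i hi n
    rw [hcoeff_X_pow_mul hψb.1]
    split_ifs with hin
    · rw [hψc]
      refine Finset.sum_congr rfl fun j _ => ?_
      congr 2; omega
    · rw [← hα (n + (N - i)) (by omega)]
      refine Finset.sum_congr rfl fun j _ => ?_
      congr 2; omega

/-- If `u` is a finite Blaschke product and `v` is inner of infinite degree,
then `𝓜(u,v) ∩ H^∞ ≠ {0}`. -/
theorem stmt_12 (u v : ℂ → ℂ) (hu : IsInner u) (hufin : IsFiniteBlaschke u)
    (hv : IsInner v) (hvinf : ¬ IsFiniteBlaschke v) :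
    ∃ φ ∈ Mult u v, MemHinf φ ∧ ∃ z ∈ ball (0 : ℂ) 1, φ z ≠ 0 := by
  obtain ⟨c, N, a, hc, ha, huz⟩ := hufin
  obtain ⟨ψ, α, hψ, ⟨z, hz, hψz⟩, hψc⟩ := exists_bounded_shift_combination hv hvinf N
  set Q : Polynomial ℂ := ∏ j, (1 - Polynomial.C ((starRingEnd ℂ) (a j)) * Polynomial.X) with hQ
  have hφ : MemHinf fun z => Q.eval z * ψ z := (memHinf_polynomial Q).mul hψ
  refine ⟨fun z => Q.eval z * ψ z, ⟨hφ.1, fun f hf => ?_⟩, hφ, z, hz, mul_ne_zero ?_ hψz⟩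
  · have hQf : DifferentiableOn ℂ (fun z => Q.eval z * f z) (ball (0 : ℂ) 1) :=
      Q.differentiable.differentiableOn.mul hf.1.1
    have hvan : ∀ n, N ≤ n → hcoeff (fun z => Q.eval z * f z) n = 0 := fun n hn =>
      hcoeff_denominator_mul_eq_zero hc ha huz hf hn
    refine mem_KSpace_of_hcoeff hv (hf.1.bounded_mul hφ) (ι := Fin N × Fin (N + 1))
      (fun p => hcoeff (fun z => Q.eval z * f z) p.1 * α p.2)
      (fun p => (p.2 : ℕ) + 1 + (N - (p.1 : ℕ))) (fun p => by omega) fun n => ?_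
    have hψd : ∀ i : Fin N, DifferentiableOn ℂ (fun z => z ^ (i : ℕ) * ψ z) (ball (0 : ℂ) 1) :=
      fun i => (by fun_prop : DifferentiableOn ℂ (fun z : ℂ => z ^ (i : ℕ)) _).mul hψ.1
    rw [hcoeff_congr (g := fun z => ∑ i : Fin N,
      hcoeff (fun z => Q.eval z * f z) i * (z ^ (i : ℕ) * ψ z)), hcoeff_sum _ fun i _ => hψd i,
      Fintype.sum_prod_type]
    · refine Finset.sum_congr rfl fun i _ => ?_
      rw [hψc i i.2.le, Finset.mul_sum]
      exact Finset.sum_congr rfl fun j _ => (mul_assoc _ _ _).symm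
    · intro w hw
      have := eqOn_sum_of_hcoeff_eq_zero hQf hvan hw
      simp only [← mul_assoc]
      rw [← Finset.sum_mul, ← this]
      ring
  · rw [hQ, Polynomial.eval_prod, Finset.prod_ne_zero_iff]
    intro j _
    simpa using one_sub_conj_mul_ne_zero (a := a j) (z := z) (by simpa using ha j)
      (by simpa using (mem_ball_zero_iff.1 hz).le)

end
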